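/- arXiv:2312.14341 — 2 statements merged into one kernel-verified Lean document; each statement's English description precedes it below -/
import Mathlib

section
/- Suppose Assumptions 1 and 2 hold and let (x^k, y^k, z^k, u^k, θ_k)_{k≥0} be generated by the constant-parameter algorithm, with θ̄ := lim_{k→∞} θ_k. Then every accumulation point (x̄, ȳ, z̄, ū) of the bounded sequence (x^k, y^k, z^k, u^k) satisfies Π(x̄, z̄, ū) = θ̄, where Π(x,z,u) := Ψ(x,z,u;δ,γ)/f(Kx). -/
open Set Filter Topology Metric

open scoped RealInnerProductSpace

noncomputable section

namespace FracPaper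

variable {E : Type*} [NormedAddCommGroup E] [InnerProductSpace ℝ E] [FiniteDimensional ℝ E]
variable {F : Type*} [NormedAddCommGroup F] [InnerProductSpace ℝ F] [FiniteDimensional ℝ F]
variable {G : Type*} [NormedAddCommGroup G] [InnerProductSpace ℝ G] [FiniteDimensional ℝ G]

/-- The effective domain of an `EReal`-valued function. -/
def edom (f : E → EReal) : Set E := {x | f x ≠ ⊤}

/-- `f` is proper: it takes values in `ℝ ∪ {+∞}` and is not identically `+∞`. -/
def ProperFn (f : E → EReal) : Prop := (∀ x, f x ≠ ⊥) ∧ ∃ x, f x ≠ ⊤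

/-- Convexity for `EReal`-valued functions. -/
def ConvexFn (f : E → EReal) : Prop :=
  ∀ x y : E, ∀ a b : ℝ, 0 ≤ a → 0 ≤ b → a + b = 1 →
    f (a • x + b • y) ≤ (a : EReal) * f x + (b : EReal) * f y

/-- The Fenchel conjugate of an `EReal`-valued function. -/
def conj (f : E → EReal) : E → EReal :=
  fun v => ⨆ x : E, ((⟪v, x⟫ : EReal) - f x)

/-- The `ε`-subdifferential (for convex functions). -/
def epsSubdiff (f : E → EReal) (ε : ℝ) (w : E) : Set E :=
  {v | f w ≠ ⊤ ∧ ∀ y : E, f w + ((⟪v, y - w⟫ - ε : ℝ) : EReal) ≤ f y}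

/-- The convex subdifferential. -/
def subdiff (f : E → EReal) (w : E) : Set E := epsSubdiff f 0 w

/-- The Fréchet subdifferential. -/
def frechetSubdiff (f : E → EReal) (w : E) : Set E :=
  {v | f w ≠ ⊤ ∧ ∀ ε : ℝ, 0 < ε →
    ∀ᶠ y in nhds w, f w + ((⟪v, y - w⟫ - ε * ‖y - w‖ : ℝ) : EReal) ≤ f y}

/-- The limiting (Mordukhovich) subdifferential. -/
def limitingSubdiff (f : E → EReal) (w : E) : Set E :=
  {v | ∃ xs vs : ℕ → E,
      Tendsto xs atTop (nhds w) ∧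
      Tendsto (fun k => f (xs k)) atTop (nhds (f w)) ∧
      Tendsto vs atTop (nhds v) ∧
      ∀ k, vs k ∈ frechetSubdiff f (xs k)}

open Classical in
/-- The indicator function of a set, with values in `EReal`. -/
def indicatorFn (S : Set E) : E → EReal := fun x => if x ∈ S then (0 : EReal) else ⊤

/-- Calmness of an `EReal`-valued function at a point. -/
def CalmAt (f : E → EReal) (x : E) : Prop :=
  ∃ ε κ : ℝ, 0 < ε ∧ 0 < κ ∧ ∀ y ∈ ball x ε,
    f y ≤ f x + ((κ * ‖y - x‖ : ℝ) : EReal) ∧ f x ≤ f y + ((κ * ‖y - x‖ : ℝ) : EReal)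

/-- Essential strict convexity: strict convexity on every convex subset of `dom ∂g`. -/
def EssStrictConvexFn (g : F → EReal) : Prop :=
  ∀ C : Set F, Convex ℝ C → (∀ w ∈ C, (subdiff g w).Nonempty) →
    ∀ x ∈ C, ∀ y ∈ C, x ≠ y → ∀ a b : ℝ, 0 < a → 0 < b → a + b = 1 →
      g (a • x + b • y) < (a : EReal) * g x + (b : EReal) * g y

/-- The Kurdyka–Łojasiewicz property at a point. -/
def KLAt (f : E → EReal) (xh : E) : Prop :=
  ∃ μ : ℝ, 0 < μ ∧ ∃ U ∈ nhds xh, ∃ φ φd : ℝ → ℝ,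
    ContinuousOn φ (Ico 0 μ) ∧ ConcaveOn ℝ (Ico 0 μ) φ ∧ φ 0 = 0 ∧
    (∀ t ∈ Ioo 0 μ, HasDerivAt φ (φd t) t ∧ 0 < φd t) ∧
    ∀ x ∈ U, f xh < f x → f x < f xh + (μ : EReal) →
      ∀ v ∈ limitingSubdiff f x, 1 ≤ φd ((f x).toReal - (f xh).toReal) * ‖v‖

/-- The augmented function `Ψ`. -/
def psi (S : Set E) (g : F → EReal) (h : E → ℝ) (A : E →L[ℝ] F) (δ γ : ℝ)
    (x : E) (z : F) (u : E) : EReal :=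
  ((⟪z, A x⟫ + h x + δ / 2 * ‖x - u‖ ^ 2 - γ / 2 * ‖z‖ ^ 2 : ℝ) : EReal)
    - conj g z + indicatorFn S x

/-- Assumption 1 of the paper. `h'` is the gradient of `h` and `Lh` its Lipschitz constant. -/
def Assumption1 (S : Set E) (g : F → EReal) (h : E → ℝ) (h' : E → E) (Lh : ℝ)
    (f : G → EReal) (A : E →L[ℝ] F) (K : E →L[ℝ] G) : Prop :=
  S.Nonempty ∧ Convex ℝ S ∧ IsCompact S ∧
  ProperFn g ∧ ConvexFn g ∧ LowerSemicontinuous g ∧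
  (∃ O : Set E, IsOpen O ∧ S ⊆ O ∧ (∀ x ∈ O, HasGradientAt h (h' x) x) ∧
      ∀ x ∈ O, ∀ y ∈ O, ‖h' x - h' y‖ ≤ Lh * ‖x - y‖) ∧
  ProperFn f ∧ ConvexFn f ∧ LowerSemicontinuous f ∧
  (∀ x ∈ S, K x ∈ interior (edom f)) ∧ (∀ x ∈ S, 0 < f (K x)) ∧
  (∃ x ∈ S, A x ∈ edom g) ∧
  (∃ α : ℝ, 0 < α ∧ ∀ x ∈ S, (α : EReal) ≤ g (A x) + (h x : EReal))

/-- Assumption 2 of the paper. -/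
def Assumption2 (S : Set E) (g : F → EReal) (A : E →L[ℝ] F) : Prop :=
  (∀ x ∈ S, (subdiff g (A x)).Nonempty) ∧
  ∃ ℓ : ℝ, 0 < ℓ ∧ ∀ x ∈ S, infDist 0 (subdiff g (A x)) ≤ ℓ

/-- The constant-parameter algorithm (FSPS with fixed `γ`, `δ`, `β`). -/
def IsAlgoSeq (S : Set E) (g : F → EReal) (h : E → ℝ) (h' : E → E) (f : G → EReal)
    (A : E →L[ℝ] F) (K : E →L[ℝ] G) (γ δ β : ℝ)
    (x u : ℕ → E) (y : ℕ → G) (z : ℕ → F) (θ : ℕ → ℝ) : Prop :=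
  x 0 ∈ S ∧
  (∀ k, ∀ ζ : F, conj g (z k) + ((-⟪z k, A (x k)⟫ + γ / 2 * ‖z k‖ ^ 2 : ℝ) : EReal)
      ≤ conj g ζ + ((-⟪ζ, A (x k)⟫ + γ / 2 * ‖ζ‖ ^ 2 : ℝ) : EReal)) ∧
  (∀ k, 0 < θ k ∧ ((θ k : ℝ) : EReal) * f (K (x k)) = psi S g h A δ γ (x k) (z k) (u k)) ∧
  (∀ k, y (k + 1) ∈ subdiff f (K (x k))) ∧
  (∀ k, x (k + 1) ∈ S ∧ ∀ w ∈ S,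
      ⟪z k, A (x (k + 1))⟫ - θ k * ⟪K (x (k + 1)), y (k + 1)⟫
          + ⟪h' (x k), x (k + 1)⟫ + δ / 2 * ‖x (k + 1) - u k‖ ^ 2
        ≤ ⟪z k, A w⟫ - θ k * ⟪K w, y (k + 1)⟫ + ⟪h' (x k), w⟫
          + δ / 2 * ‖w - u k‖ ^ 2) ∧
  (∀ k, u (k + 1) = (1 - β) • u k + β • x (k + 1))

/-- `x̄` is a limiting `(ε₁, ε₂)`-lifted stationary point of the fractional program. -/
def IsLiftedStat (S : Set E) (g : F → EReal) (h : E → ℝ) (h' : E → E) (f : G → EReal)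
    (A : E →L[ℝ] F) (K : E →L[ℝ] G) (ε₁ ε₂ : ℝ) (xb : E) : Prop :=
  ∃ Ψb : ℝ, |Ψb - ((g (A xb)).toReal + h xb)| ≤ ε₂ ∧
    ∃ v ∈ epsSubdiff g ε₁ (A xb), ∃ w ∈ subdiff (indicatorFn S) xb,
      ∃ s ∈ subdiff f (K xb),
        (f (K xb)).toReal • (ContinuousLinearMap.adjoint A v + h' xb + w)
          - Ψb • (ContinuousLinearMap.adjoint K s) = 0


/-- The merit function `Π` evaluated componentwise. -/
def piPt (S : Set E) (g : F → EReal) (h : E → ℝ) (f : G → EReal)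
    (A : E →L[ℝ] F) (K : E →L[ℝ] G) (δ γ : ℝ) (x : E) (z : F) (u : E) : EReal :=
  psi S g h A δ γ x z u / f (K x)

/-- The merit function `Γ` evaluated componentwise. -/
def gamPt (S : Set E) (g : F → EReal) (h : E → ℝ) (f : G → EReal)
    (A : E →L[ℝ] F) (K : E →L[ℝ] G) (δ γ : ℝ) (x : E) (y : G) (z : F) (u : E) : EReal :=
  psi S g h A δ γ x z u / (((⟪K x, y⟫ : ℝ) : EReal) - conj f y)

theorem continuousOn_toReal_interior_edom {f : E → EReal} (hf : ProperFn f) (hc : ConvexFn f) :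
    ContinuousOn (fun x => (f x).toReal) (interior (edom f)) := by
  have key : ∀ x ∈ edom f, ∀ y ∈ edom f, ∀ a b : ℝ, 0 ≤ a → 0 ≤ b → a + b = 1 →
      f (a • x + b • y) ≤ ((a * (f x).toReal + b * (f y).toReal : ℝ) : EReal) := by
    intro x hx y hy a b ha hb hab
    have := hc x y a b ha hb hab
    rwa [← EReal.coe_toReal hx (hf.1 x), ← EReal.coe_toReal hy (hf.1 y)] at this
  have hconv : ConvexOn ℝ (edom f) (fun x => (f x).toReal) := by
    refine ⟨fun x hx y hy a b ha hb hab => ?_, fun x hx y hy a b ha hb hab => ?_⟩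
    · exact ne_top_of_le_ne_top (EReal.coe_ne_top _) (key x hx y hy a b ha hb hab)
    · exact EReal.toReal_le_toReal (key x hx y hy a b ha hb hab) (hf.1 _) (EReal.coe_ne_top _)
  exact hconv.continuousOn_interior

theorem conj_le_of_tendsto {H : Type*} [NormedAddCommGroup H] [InnerProductSpace ℝ H]
    {ι : Type*} {l : Filter ι} [l.NeBot] {g : H → EReal}
    (hg : ProperFn g) {z : ι → H} {c : ι → ℝ} {zb : H} {L : ℝ}
    (hz : Tendsto z l (nhds zb)) (hc : Tendsto c l (nhds L))
    (hle : ∀ i, conj g (z i) ≤ (c i : EReal)) : conj g zb ≤ (L : EReal) := by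
  refine iSup_le fun x => ?_
  by_cases hx : g x = ⊤
  · simp [hx]
  have hreal : ∀ i, ⟪z i, x⟫ - (g x).toReal ≤ c i := fun i => by
    have h := (le_iSup (fun x => ((⟪z i, x⟫ : EReal) - g x)) x).trans (hle i)
    rw [← EReal.coe_toReal hx (hg.1 x)] at h
    exact_mod_cast h
  have hlim : ⟪zb, x⟫ - (g x).toReal ≤ L :=
    le_of_tendsto_of_tendsto' ((hz.inner tendsto_const_nhds).sub_const _) hc hreal
  rw [← EReal.coe_toReal hx (hg.1 x)]
  exact_mod_cast hlim

theorem eq_coe_sub_of_coe_eq_coe_sub {a r : ℝ} {c : EReal} (h : (a : EReal) = r - c) :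
    c = ((r - a : ℝ) : EReal) := by
  induction c with
  | bot => simp at h
  | top => simp at h
  | coe c =>
    norm_cast at h ⊢
    linarith

/-- every accumulation point realizes the limit value of `Π`. -/
theorem accumulation_point_Pi_eq
    (S : Set E) (g : F → EReal) (h : E → ℝ) (h' : E → E) (Lh : ℝ)
    (f : G → EReal) (A : E →L[ℝ] F) (K : E →L[ℝ] G)
    (hA1 : Assumption1 S g h h' Lh f A K) (hA2 : Assumption2 S g A)
    (γ ν β δ : ℝ) (hγ : 0 < γ) (hν : 0 < ν) (hβ : β ∈ Ioo (0 : ℝ) 2)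
    (hδ : δ = 2 * ν + Lh + 2 * ‖A‖ ^ 2 / γ)
    (x u : ℕ → E) (y : ℕ → G) (z : ℕ → F) (θ : ℕ → ℝ)
    (halg : IsAlgoSeq S g h h' f A K γ δ β x u y z θ)
    (θbar : ℝ) (hθbar : Tendsto θ atTop (nhds θbar))
    (xb : E) (yb : G) (zb : F) (ub : E) (φ : ℕ → ℕ) (hφ : StrictMono φ)
    (hx : Tendsto (fun j => x (φ j)) atTop (nhds xb))
    (hy : Tendsto (fun j => y (φ j)) atTop (nhds yb))
    (hz : Tendsto (fun j => z (φ j)) atTop (nhds zb))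
    (hu : Tendsto (fun j => u (φ j)) atTop (nhds ub)) :
    piPt S g h f A K δ γ xb zb ub = ((θbar : ℝ) : EReal) := by
  obtain ⟨-, -, hS, hg, -, -, ⟨O, -, hSO, hgrad, -⟩, hf, hfc, -, hKint, hfpos, -, -⟩ := hA1
  obtain ⟨hx0, hprox, hθ, -, hxu, -⟩ := halg
  have hxS : ∀ k, x k ∈ S := fun k => by
    cases k with
    | zero => exact hx0
    | succ k => exact (hxu k).1
  have hxbS : xb ∈ S := hS.isClosed.mem_of_tendsto hx (.of_forall fun j => hxS _)
  have hfcoe : ∀ w ∈ S, ((f (K w)).toReal : EReal) = f (K w) := fun w hw =>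
    EReal.coe_toReal (interior_subset (hKint w hw)) (hf.1 _)
  have hflim : Tendsto (fun j => (f (K (x (φ j)))).toReal) atTop (nhds (f (K xb)).toReal) :=
    ((continuousOn_toReal_interior_edom hf hfc).continuousAt
      (isOpen_interior.mem_nhds (hKint xb hxbS))).tendsto.comp ((K.continuous.tendsto xb).comp hx)
  have hhlim : Tendsto (fun j => h (x (φ j))) atTop (nhds (h xb)) :=
    ((hgrad xb (hSO hxbS)).continuousAt.tendsto).comp hx
  have hAx : Tendsto (fun j => A (x (φ j))) atTop (nhds (A xb)) := (A.continuous.tendsto xb).comp hx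
  have hsq : Tendsto (fun j => γ / 2 * ‖z (φ j)‖ ^ 2) atTop (nhds (γ / 2 * ‖zb‖ ^ 2)) :=
    (hz.norm.pow 2).const_mul _
  let r : E → F → E → ℝ := fun x z u =>
    ⟪z, A x⟫ + h x + δ / 2 * ‖x - u‖ ^ 2 - γ / 2 * ‖z‖ ^ 2
  have hpsi : ∀ w ∈ S, ∀ (ζ : F) (v : E), psi S g h A δ γ w ζ v = (r w ζ v : EReal) - conj g ζ := by
    intro w hw ζ v
    simp [psi, indicatorFn, hw, r]
  have hrlim : Tendsto (fun j => r (x (φ j)) (z (φ j)) (u (φ j))) atTop (nhds (r xb zb ub)) :=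
    (((hz.inner hAx).add hhlim).add (((hx.sub hu).norm.pow 2).const_mul _)).sub hsq
  let c : ℕ → ℝ := fun k => r (x k) (z k) (u k) - θ k * (f (K (x k))).toReal
  have hconj : ∀ k, conj g (z k) = (c k : EReal) := fun k => by
    have h := (hθ k).2
    rw [hpsi _ (hxS k), ← hfcoe _ (hxS k), ← EReal.coe_mul] at h
    exact eq_coe_sub_of_coe_eq_coe_sub h
  have hclim : Tendsto (fun j => c (φ j)) atTop
      (nhds (r xb zb ub - θbar * (f (K xb)).toReal)) :=
    hrlim.sub ((hθbar.comp hφ.tendsto_atTop).mul hflim)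
  have hle : conj g zb ≤ ((r xb zb ub - θbar * (f (K xb)).toReal : ℝ) : EReal) :=
    conj_le_of_tendsto hg hz hclim fun j => (hconj (φ j)).le
  have hconjb : conj g zb = ((r xb zb ub - θbar * (f (K xb)).toReal : ℝ) : EReal) := by
    refine le_antisymm hle ?_
    have hbot : conj g zb ≠ ⊥ := fun hb => by
      have h := hprox 0 zb
      rw [hconj, hb, EReal.bot_add, le_bot_iff, ← EReal.coe_add] at h
      exact EReal.coe_ne_bot _ h
    have hcoe := EReal.coe_toReal (ne_top_of_le_ne_top (EReal.coe_ne_top _) hle) hbot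
    rw [← hcoe, EReal.coe_le_coe_iff]
    have hineq : ∀ j, c (φ j) + (-⟪z (φ j), A (x (φ j))⟫ + γ / 2 * ‖z (φ j)‖ ^ 2) ≤
        (conj g zb).toReal + (-⟪zb, A (x (φ j))⟫ + γ / 2 * ‖zb‖ ^ 2) := fun j => by
      have h := hprox (φ j) zb
      rw [hconj, ← hcoe] at h
      exact_mod_cast h
    have hlim := le_of_tendsto_of_tendsto' (hclim.add ((hz.inner hAx).neg.add hsq))
      ((((tendsto_const_nhds (x := zb)).inner hAx).neg.add_const _).const_add _) hineq
    linarith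
  have hpos : 0 < (f (K xb)).toReal := by
    have h := hfpos xb hxbS
    rw [← hfcoe xb hxbS] at h
    exact_mod_cast h
  rw [piPt, hpsi xb hxbS, hconjb, ← hfcoe xb hxbS, ← EReal.coe_sub, ← EReal.coe_div,
    EReal.toReal_coe, sub_sub_cancel, mul_div_cancel_right₀ _ hpos.ne']

end FracPaper
end
end

section
/- Suppose Assumptions 1 and 2 hold and let (x^k, y^k, z^k, u^k, θ_k)_{k≥0} be generated by the constant-parameter algorithm, and suppose, for a fixed ε > 0, that ‖z^{k+1}‖ ≤ min(ε/γ, √(2ε/γ)) for all k ≥ 0. If K_ε := {w ∈ ℝˢ : dist(w, A(S)) ≤ ε} ⊆ int(dom g), then g is Lipschitz continuous on the compact set K_ε with some constant κ > 0, and every accumulation point of the sequence {x^k} is a limiting (2κε, (2κ+1)ε)-lifted stationary point of problem (P). -/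
open Set Filter Topology Metric

open scoped RealInnerProductSpace

noncomputable section

namespace FracPaper

variable {E : Type*} [NormedAddCommGroup E] [InnerProductSpace ℝ E] [FiniteDimensional ℝ E]
variable {F : Type*} [NormedAddCommGroup F] [InnerProductSpace ℝ F] [FiniteDimensional ℝ F]
variable {G : Type*} [NormedAddCommGroup G] [InnerProductSpace ℝ G] [FiniteDimensional ℝ G]

set_option linter.unusedSectionVars false

lemma ProperFn.coe_toReal {f : E → EReal} (hf : ProperFn f) {x : E} (hx : x ∈ edom f) :
    ((f x).toReal : EReal) = f x :=
  EReal.coe_toReal hx (hf.1 x)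

lemma ConvexFn.convexOn_toReal {f : E → EReal} (hp : ProperFn f) (hf : ConvexFn f) :
    ConvexOn ℝ (edom f) fun x => (f x).toReal := by
  have key : ∀ x ∈ edom f, ∀ y ∈ edom f, ∀ a b : ℝ, 0 ≤ a → 0 ≤ b → a + b = 1 →
      f (a • x + b • y) ≤ ((a * (f x).toReal + b * (f y).toReal : ℝ) : EReal) := by
    intro x hx y hy a b ha hb hab
    have := hf x y a b ha hb hab
    rwa [← hp.coe_toReal hx, ← hp.coe_toReal hy, ← EReal.coe_mul, ← EReal.coe_mul,
      ← EReal.coe_add] at this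
  have hconv : Convex ℝ (edom f) := fun x hx y hy a b ha hb hab =>
    ((key x hx y hy a b ha hb hab).trans_lt (EReal.coe_lt_top _)).ne
  refine ⟨hconv, fun x hx y hy a b ha hb hab => ?_⟩
  have := key x hx y hy a b ha hb hab
  rw [← hp.coe_toReal (hconv hx hy ha hb hab)] at this
  exact EReal.coe_le_coe_iff.1 this

lemma mem_epsSubdiff_iff {f : E → EReal} (hp : ProperFn f) {ε : ℝ} {v w : E} :
    v ∈ epsSubdiff f ε w ↔
      w ∈ edom f ∧ ∀ y ∈ edom f, (f w).toReal + (⟪v, y - w⟫ - ε) ≤ (f y).toReal := by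
  refine and_congr_right fun hw => ⟨fun h y hy => ?_, fun h y => ?_⟩
  · have := h y
    rw [← hp.coe_toReal hw, ← hp.coe_toReal hy, ← EReal.coe_add] at this
    exact EReal.coe_le_coe_iff.1 this
  · by_cases hy : f y = ⊤
    · rw [hy]; exact le_top
    · rw [← hp.coe_toReal hw, ← hp.coe_toReal (x := y) hy, ← EReal.coe_add]
      exact EReal.coe_le_coe_iff.2 (h y hy)

lemma mem_subdiff_iff {f : E → EReal} (hp : ProperFn f) {v w : E} :
    v ∈ subdiff f w ↔
      w ∈ edom f ∧ ∀ y ∈ edom f, (f w).toReal + ⟪v, y - w⟫ ≤ (f y).toReal := by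
  simp [subdiff, mem_epsSubdiff_iff hp]

lemma mem_subdiff_indicatorFn {S : Set E} {v w : E} (hw : w ∈ S)
    (h : ∀ y ∈ S, ⟪v, y - w⟫ ≤ 0) : v ∈ subdiff (indicatorFn S) w := by
  refine ⟨by simp [indicatorFn, hw], fun y => ?_⟩
  by_cases hy : y ∈ S
  · simpa [indicatorFn, hw, hy] using h y hy
  · simp [indicatorFn, hy]

/-- Fenchel's equality at a subgradient. -/
lemma conj_eq_of_mem_subdiff {f : E → EReal} (hp : ProperFn f) {v w : E}
    (h : v ∈ subdiff f w) : conj f v = ((⟪v, w⟫ - (f w).toReal : ℝ) : EReal) := by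
  obtain ⟨hw, h⟩ := (mem_subdiff_iff hp).1 h
  refine le_antisymm (iSup_le fun y => ?_) ?_
  · by_cases hy : f y = ⊤
    · simp [hy]
    · rw [← hp.coe_toReal (x := y) hy, ← EReal.coe_sub]
      refine EReal.coe_le_coe_iff.2 ?_
      have := h y hy
      rw [inner_sub_right] at this
      linarith
  · refine le_trans (le_of_eq ?_) (le_iSup _ w)
    rw [EReal.coe_sub, hp.coe_toReal hw]

lemma le_conj {f : E → EReal} (hp : ProperFn f) {w : E} (hw : w ∈ edom f) (v : E) :
    ((⟪v, w⟫ - (f w).toReal : ℝ) : EReal) ≤ conj f v := by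
  refine le_trans (le_of_eq ?_) (le_iSup _ w)
  rw [EReal.coe_sub, hp.coe_toReal hw]

/-- Existence of the proximal point of a lower semicontinuous function having a subgradient. -/
lemma exists_prox {f : E → EReal} (hp : ProperFn f) (hl : LowerSemicontinuous f) {a v : E}
    (hv : v ∈ subdiff f a) {γ : ℝ} (hγ : 0 < γ) :
    ∃ p ∈ edom f, ∀ w ∈ edom f,
      (f p).toReal + 1 / (2 * γ) * ‖p - a‖ ^ 2 ≤ (f w).toReal + 1 / (2 * γ) * ‖w - a‖ ^ 2 := by
  obtain ⟨ha, hv⟩ := (mem_subdiff_iff hp).1 hv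
  have hlsc : LowerSemicontinuous
      fun w => f w + ((1 / (2 * γ) * ‖w - a‖ ^ 2 : ℝ) : EReal) := by
    refine hl.add' (Continuous.lowerSemicontinuous ?_) fun x => ?_
    · exact continuous_coe_real_ereal.comp (by fun_prop)
    · exact EReal.continuousAt_add (Or.inr (EReal.coe_ne_bot _)) (Or.inr (EReal.coe_ne_top _))
  obtain ⟨p, -, hpmin⟩ := (hlsc.lowerSemicontinuousOn (closedBall a (2 * γ * ‖v‖))).exists_isMinOn
    ⟨a, mem_closedBall_self (by positivity)⟩ (isCompact_closedBall _ _)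
  have hpa := hpmin (mem_closedBall_self (by positivity : 0 ≤ 2 * γ * ‖v‖))
  have hpd : p ∈ edom f := by
    intro htop
    simp only [mem_ofPred_eq, htop, EReal.top_add_coe, top_le_iff] at hpa
    rw [← hp.coe_toReal ha, ← EReal.coe_add] at hpa
    exact EReal.coe_ne_top _ hpa
  have conv : ∀ w ∈ edom f, f p + ((1 / (2 * γ) * ‖p - a‖ ^ 2 : ℝ) : EReal) ≤
      f w + ((1 / (2 * γ) * ‖w - a‖ ^ 2 : ℝ) : EReal) →
      (f p).toReal + 1 / (2 * γ) * ‖p - a‖ ^ 2 ≤ (f w).toReal + 1 / (2 * γ) * ‖w - a‖ ^ 2 := by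
    intro w hw h
    rw [← hp.coe_toReal hw, ← hp.coe_toReal hpd, ← EReal.coe_add, ← EReal.coe_add] at h
    exact EReal.coe_le_coe_iff.1 h
  refine ⟨p, hpd, fun w hw => ?_⟩
  by_cases hwb : w ∈ closedBall a (2 * γ * ‖v‖)
  · exact conv w hw (hpmin hwb)
  · have h1 := conv a ha hpa
    have h2 := hv w hw
    have h3 := neg_le_of_abs_le (abs_real_inner_le_norm v (w - a))
    rw [mem_closedBall, dist_eq_norm, not_le] at hwb
    have h4 : ‖v‖ * ‖w - a‖ ≤ 1 / (2 * γ) * ‖w - a‖ ^ 2 := by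
      rw [div_mul_eq_mul_div, le_div_iff₀ (by positivity)]
      nlinarith [norm_nonneg (w - a)]
    simp only [sub_self, norm_zero] at h1
    linarith

/-- The optimality condition of the proximal point. -/
lemma mem_subdiff_of_prox {f : E → EReal} (hp : ProperFn f) (hf : ConvexFn f) {a p : E}
    {γ : ℝ} (hγ : 0 < γ) (hpd : p ∈ edom f)
    (hmin : ∀ w ∈ edom f,
      (f p).toReal + 1 / (2 * γ) * ‖p - a‖ ^ 2 ≤ (f w).toReal + 1 / (2 * γ) * ‖w - a‖ ^ 2) :
    γ⁻¹ • (a - p) ∈ subdiff f p := by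
  have hconv := hf.convexOn_toReal hp
  refine (mem_subdiff_iff hp).2 ⟨hpd, fun w hw => ?_⟩
  set D := (f w).toReal - (f p).toReal with hD
  have key : ∀ t : ℝ, t ∈ Ioo (0 : ℝ) 1 →
      0 ≤ D + γ⁻¹ * ⟪p - a, w - p⟫ + t * (1 / (2 * γ) * ‖w - p‖ ^ 2) := by
    intro t ht
    have h0 : (1 - t) + t = 1 := by ring
    have h1 := hconv.2 hpd hw (sub_nonneg.2 ht.2.le) ht.1.le h0
    have h2 := hmin _ (hconv.1 hpd hw (sub_nonneg.2 ht.2.le) ht.1.le h0)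
    have h3 : (1 - t) • p + t • w - a = (p - a) + t • (w - p) := by module
    rw [h3, norm_add_sq_real, inner_smul_right, norm_smul, Real.norm_of_nonneg ht.1.le] at h2
    simp only [smul_eq_mul] at h1
    have h4 : 1 / (2 * γ) * (‖p - a‖ ^ 2 + 2 * (t * ⟪p - a, w - p⟫) + (t * ‖w - p‖) ^ 2) =
      1 / (2 * γ) * ‖p - a‖ ^ 2 +
        t * (γ⁻¹ * ⟪p - a, w - p⟫ + t * (1 / (2 * γ) * ‖w - p‖ ^ 2)) := by
      field_simp
      ring
    refine nonneg_of_mul_nonneg_right (a := t) ?_ ht.1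
    rw [h4] at h2
    rw [hD]
    linarith
  have hlim : Tendsto (fun t : ℝ => D + γ⁻¹ * ⟪p - a, w - p⟫ +
      t * (1 / (2 * γ) * ‖w - p‖ ^ 2)) (𝓝[>] 0)
      (𝓝 (D + γ⁻¹ * ⟪p - a, w - p⟫ + 0 * (1 / (2 * γ) * ‖w - p‖ ^ 2))) :=
    (Continuous.tendsto (by fun_prop) 0).mono_left nhdsWithin_le_nhds
  have := ge_of_tendsto hlim (by
    filter_upwards [Ioo_mem_nhdsGT (zero_lt_one' ℝ)] with t ht using key t ht)
  rw [inner_smul_left, ← neg_sub p a, inner_neg_left]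
  simp only [conj_trivial]
  linarith

/-- The minimizer of the regularized conjugate is a subgradient at the proximal point. -/
lemma mem_subdiff_of_conj_prox {f : E → EReal} (hp : ProperFn f) (hf : ConvexFn f)
    (hl : LowerSemicontinuous f) {a v : E} (hv : v ∈ subdiff f a) {γ : ℝ} (hγ : 0 < γ) {z : E}
    (hz : ∀ ζ : E, conj f z + ((-⟪z, a⟫ + γ / 2 * ‖z‖ ^ 2 : ℝ) : EReal)
      ≤ conj f ζ + ((-⟪ζ, a⟫ + γ / 2 * ‖ζ‖ ^ 2 : ℝ) : EReal)) :
    z ∈ subdiff f (a - γ • z) := by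
  obtain ⟨p, hpd, hmin⟩ := exists_prox hp hl hv hγ
  have hsub := mem_subdiff_of_prox hp hf hγ hpd hmin
  set ζ := γ⁻¹ • (a - p) with hζ
  have hp_eq : p = a - γ • ζ := by rw [hζ, smul_inv_smul₀ hγ.ne']; abel
  have h1 := (add_le_add_left (le_conj hp hpd z) _).trans (hz ζ)
  rw [conj_eq_of_mem_subdiff hp hsub, ← EReal.coe_add, ← EReal.coe_add,
    EReal.coe_le_coe_iff] at h1
  have h2 : γ / 2 * ‖z - ζ‖ ^ 2 ≤ 0 := by
    rw [norm_sub_sq_real]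
    have e1 : ⟪z, p⟫ = ⟪z, a⟫ - γ * ⟪z, ζ⟫ := by rw [hp_eq, inner_sub_right, inner_smul_right]
    have e2 : ⟪ζ, p⟫ = ⟪ζ, a⟫ - γ * ‖ζ‖ ^ 2 := by
      rw [hp_eq, inner_sub_right, inner_smul_right, real_inner_self_eq_norm_sq]
    rw [e1, e2] at h1
    linarith
  have h3 : z = ζ := by
    have : ‖z - ζ‖ ^ 2 = 0 :=
      le_antisymm (nonpos_of_mul_nonpos_right h2 (half_pos hγ)) (sq_nonneg _)
    exact sub_eq_zero.1 (norm_eq_zero.1 (pow_eq_zero_iff two_ne_zero |>.1 this))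
  rw [h3, ← hp_eq]
  exact hsub

/-- The descent lemma along a segment. -/
lemma le_add_inner_add_of_lipschitz_gradient {h : E → ℝ} {h' : E → E} {L : ℝ} {S : Set E}
    (hS : Convex ℝ S) (hgrad : ∀ x ∈ S, HasGradientAt h (h' x) x)
    (hlip : ∀ x ∈ S, ∀ y ∈ S, ‖h' x - h' y‖ ≤ L * ‖x - y‖) {a b : E} (ha : a ∈ S) (hb : b ∈ S) :
    h b ≤ h a + ⟪h' a, b - a⟫ + L / 2 * ‖b - a‖ ^ 2 := by
  set d := b - a with hd
  have hseg : ∀ t ∈ Icc (0 : ℝ) 1, a + t • d ∈ S := fun t ht =>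
    hS.add_smul_sub_mem ha hb ht
  have hder : ∀ t ∈ Icc (0 : ℝ) 1, HasDerivAt
      (fun s : ℝ => h (a + s • d) - s * ⟪h' a, d⟫ - L / 2 * ‖d‖ ^ 2 * s ^ 2)
      (⟪h' (a + t • d), d⟫ - ⟪h' a, d⟫ - L * ‖d‖ ^ 2 * t) t := by
    intro t ht
    have h1 : HasDerivAt (fun s : ℝ => a + s • d) d t := by
      simpa using ((hasDerivAt_id t).smul_const d).const_add a
    have h2 := (hgrad _ (hseg t ht)).hasFDerivAt.comp_hasDerivAt t h1
    refine ((h2.sub ((hasDerivAt_id t).mul_const ⟪h' a, d⟫)).sub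
      ((hasDerivAt_pow 2 t).const_mul (L / 2 * ‖d‖ ^ 2))).congr_deriv ?_
    simp
    ring
  have hanti := antitoneOn_of_hasDerivWithinAt_nonpos (convex_Icc (0 : ℝ) 1)
    (fun t ht => (hder t ht).continuousAt.continuousWithinAt)
    (fun t ht => (hder t (interior_subset ht)).hasDerivWithinAt)
    (fun t ht => by
      have ht := interior_subset ht
      have h1 := hlip _ (hseg t ht) a ha
      rw [add_sub_cancel_left, norm_smul, Real.norm_of_nonneg ht.1] at h1
      have h2 := real_inner_le_norm (h' (a + t • d) - h' a) d
      rw [inner_sub_left] at h2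
      nlinarith [mul_le_mul_of_nonneg_right h1 (norm_nonneg d)])
  have := hanti (left_mem_Icc.2 zero_le_one) (right_mem_Icc.2 zero_le_one) zero_le_one
  have hb' : a + d = b := by rw [hd]; abel
  simp only [one_smul, zero_smul, hb', add_zero] at this
  linarith

/-- Subgradients near a point of local Lipschitz continuity are bounded. -/
lemma norm_le_of_mem_subdiff {f : E → EReal} (hp : ProperFn f) {U : Set E} {C : NNReal}
    (hlip : LipschitzOnWith C (fun x => (f x).toReal) U) (hU : U ⊆ edom f) {a v : E}
    (ha : U ∈ 𝓝 a) (hv : v ∈ subdiff f a) : ‖v‖ ≤ C := by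
  have hv := ((mem_subdiff_iff hp).1 hv).2
  have hlim : Tendsto (fun t : ℝ => a + t • v) (𝓝[>] 0) (𝓝 a) := by
    have : Tendsto (fun t : ℝ => a + t • v) (𝓝 0) (𝓝 (a + (0 : ℝ) • v)) :=
      Continuous.tendsto (by fun_prop) 0
    simpa using this.mono_left nhdsWithin_le_nhds
  obtain ⟨t, htU, ht : 0 < t⟩ := ((hlim.eventually ha).and self_mem_nhdsWithin).exists
  have h1 := hv _ (hU htU)
  have h2 := (le_abs_self _).trans (hlip.dist_le_mul _ htU _ (mem_of_mem_nhds ha))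
  rw [add_sub_cancel_left, inner_smul_right, real_inner_self_eq_norm_sq] at h1
  rw [dist_eq_norm, add_sub_cancel_left, norm_smul, Real.norm_of_nonneg ht.le] at h2
  have h3 : ‖v‖ * (t * ‖v‖) ≤ C * (t * ‖v‖) := by nlinarith
  by_contra! hlt
  have hv0 : 0 < ‖v‖ := C.2.trans_lt hlt
  exact hlt.not_ge (le_of_mul_le_mul_right h3 (by positivity))

/-- The variational inequality for a quadratically regularized linear problem. -/
lemma inner_nonneg_of_forall_le {S : Set E} (hS : Convex ℝ S) {c u p : E} {δ : ℝ} (hp : p ∈ S)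
    (hmin : ∀ w ∈ S, ⟪c, p⟫ + δ / 2 * ‖p - u‖ ^ 2 ≤ ⟪c, w⟫ + δ / 2 * ‖w - u‖ ^ 2)
    {w : E} (hw : w ∈ S) : 0 ≤ ⟪c + δ • (p - u), w - p⟫ := by
  have key : ∀ t ∈ Ioo (0 : ℝ) 1,
      0 ≤ ⟪c + δ • (p - u), w - p⟫ + t * (δ / 2 * ‖w - p‖ ^ 2) := by
    intro t ht
    have h1 := hmin _ (hS.add_smul_sub_mem hp hw ⟨ht.1.le, ht.2.le⟩)
    have h2 : p + t • (w - p) - u = (p - u) + t • (w - p) := by abel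
    rw [h2, norm_add_sq_real, inner_smul_right, norm_smul, Real.norm_of_nonneg ht.1.le,
      inner_add_right, inner_smul_right] at h1
    refine nonneg_of_mul_nonneg_right (a := t) ?_ ht.1
    rw [inner_add_left, inner_smul_left, conj_trivial]
    linarith
  have hlim : Tendsto (fun t : ℝ => ⟪c + δ • (p - u), w - p⟫ + t * (δ / 2 * ‖w - p‖ ^ 2))
      (𝓝[>] 0) (𝓝 (⟪c + δ • (p - u), w - p⟫ + 0 * (δ / 2 * ‖w - p‖ ^ 2))) :=
    (Continuous.tendsto (by fun_prop) 0).mono_left nhdsWithin_le_nhds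
  have := ge_of_tendsto hlim (by
    filter_upwards [Ioo_mem_nhdsGT (zero_lt_one' ℝ)] with t ht using key t ht)
  simpa using this

/-- The Moreau envelope, evaluated through its proximal points, has a `γ⁻¹`-Lipschitz gradient. -/
lemma envelope_le {f : E → EReal} (hp : ProperFn f) {γ : ℝ} (hγ : 0 < γ) {a b z w : E}
    (hz : z ∈ subdiff f (a - γ • z)) (hw : w ∈ subdiff f (b - γ • w)) :
    (f (b - γ • w)).toReal + γ / 2 * ‖w‖ ^ 2 ≤
      (f (a - γ • z)).toReal + γ / 2 * ‖z‖ ^ 2 + ⟪z, b - a⟫ + 1 / (2 * γ) * ‖b - a‖ ^ 2 := by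
  have h1 := ((mem_subdiff_iff hp).1 hw).2 _ ((mem_subdiff_iff hp).1 hz).1
  have h2 : a - γ • z - (b - γ • w) = γ • (w - z) - (b - a) := by module
  have h3 : ⟪w, a - γ • z - (b - γ • w)⟫ =
      γ * (‖w‖ ^ 2 - ⟪w, z⟫) - ⟪w, b - a⟫ := by
    rw [h2, inner_sub_right, inner_smul_right, inner_sub_right w w z, real_inner_self_eq_norm_sq]
  have h4 : 0 ≤ 1 / (2 * γ) * ‖γ • (w - z) - (b - a)‖ ^ 2 := by positivity
  have h5 : 1 / (2 * γ) * ‖γ • (w - z) - (b - a)‖ ^ 2 =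
      γ / 2 * (‖w‖ ^ 2 - 2 * ⟪w, z⟫ + ‖z‖ ^ 2) - (⟪w, b - a⟫ - ⟪z, b - a⟫) +
        1 / (2 * γ) * ‖b - a‖ ^ 2 := by
    rw [norm_sub_sq_real, norm_smul, Real.norm_of_nonneg hγ.le, mul_pow, norm_sub_sq_real,
      inner_smul_left, inner_sub_left, conj_trivial]
    field_simp
  rw [h3] at h1
  linarith

lemma psi_eq_coe {S : Set E} {g : F → EReal} (hp : ProperFn g) (h : E → ℝ) (A : E →L[ℝ] F)
    (δ γ : ℝ) {x u : E} {z : F} (hx : x ∈ S) (hz : z ∈ subdiff g (A x - γ • z)) :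
    psi S g h A δ γ x z u = (((g (A x - γ • z)).toReal + γ / 2 * ‖z‖ ^ 2 + h x
      + δ / 2 * ‖x - u‖ ^ 2 : ℝ) : EReal) := by
  rw [psi, conj_eq_of_mem_subdiff hp hz, ← EReal.coe_sub]
  simp only [indicatorFn, hx, if_true, add_zero]
  rw [inner_sub_right, inner_smul_right, real_inner_self_eq_norm_sq]
  congr 1
  ring

/-- A Lipschitz constant on a nonempty open set is nonnegative unless the space is trivial. -/
lemma mul_norm_sq_nonneg_of_lipschitz {h' : E → E} {L : ℝ} {O : Set E} (hO : IsOpen O)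
    (hne : O.Nonempty) (hlip : ∀ x ∈ O, ∀ y ∈ O, ‖h' x - h' y‖ ≤ L * ‖x - y‖) (v : E) :
    0 ≤ L * ‖v‖ ^ 2 := by
  obtain ⟨a, ha⟩ := hne
  have hlim : Tendsto (fun t : ℝ => a + t • v) (𝓝[>] 0) (𝓝 a) := by
    have : Tendsto (fun t : ℝ => a + t • v) (𝓝 0) (𝓝 (a + (0 : ℝ) • v)) :=
      Continuous.tendsto (by fun_prop) 0
    simpa using this.mono_left nhdsWithin_le_nhds
  obtain ⟨t, htO, ht : 0 < t⟩ :=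
    ((hlim.eventually (hO.mem_nhds ha)).and self_mem_nhdsWithin).exists
  have h1 := (norm_nonneg _).trans (hlip _ htO a ha)
  rw [add_sub_cancel_left, norm_smul, Real.norm_of_nonneg ht.le] at h1
  have h2 : 0 ≤ L * ‖v‖ := nonneg_of_mul_nonneg_right (a := t) (by linarith) ht
  nlinarith [norm_nonneg v]

/-- A sequence controlled by the decrements of a positive sequence vanishes. -/
lemma tendsto_of_le_mul_sub {θ a F : ℕ → ℝ} {M : ℝ} (hθ : ∀ k, 0 < θ k) (ha : ∀ k, 0 ≤ a k)
    (hF : ∀ k, 0 < F k) (hM : ∀ k, F k ≤ M) (h : ∀ k, a k ≤ F (k + 1) * (θ k - θ (k + 1))) :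
    (∃ l, Tendsto θ atTop (𝓝 l)) ∧ Tendsto a atTop (𝓝 0) := by
  have hdec : ∀ k, 0 ≤ θ k - θ (k + 1) := fun k =>
    nonneg_of_mul_nonneg_right ((ha k).trans (h k)) (hF (k + 1))
  have hanti : Antitone θ := antitone_nat_of_succ_le fun k => sub_nonneg.1 (hdec k)
  have hl := tendsto_atTop_ciInf hanti ⟨0, by rintro _ ⟨k, rfl⟩; exact (hθ k).le⟩
  refine ⟨⟨_, hl⟩, ?_⟩
  have h1 : Tendsto (fun k => M * (θ k - θ (k + 1))) atTop (𝓝 0) := by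
    simpa using (hl.sub (hl.comp (tendsto_add_atTop_nat 1))).const_mul M
  exact squeeze_zero ha (fun k => (h k).trans
    (mul_le_mul_of_nonneg_right (hM (k + 1)) (hdec k))) h1

/-- The proximal points of the algorithm. -/
lemma IsAlgoSeq.mem_subdiff {S : Set E} {g : F → EReal} {h : E → ℝ} {h' : E → E} {f : G → EReal}
    {A : E →L[ℝ] F} {K : E →L[ℝ] G} {γ δ β Lh : ℝ} {x u : ℕ → E} {y : ℕ → G} {z : ℕ → F}
    {θ : ℕ → ℝ} (halg : IsAlgoSeq S g h h' f A K γ δ β x u y z θ)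
    (hA1 : Assumption1 S g h h' Lh f A K) (hA2 : Assumption2 S g A) (hγ : 0 < γ) (k : ℕ) :
    x k ∈ S ∧ z k ∈ subdiff g (A (x k) - γ • z k) := by
  obtain ⟨hx0, hz, -, -, hx, -⟩ := halg
  obtain ⟨-, -, -, hgp, hgc, hgl, -⟩ := hA1
  have hxS : x k ∈ S := by
    cases k with
    | zero => exact hx0
    | succ k => exact (hx k).1
  obtain ⟨v, hv⟩ := hA2.1 _ hxS
  exact ⟨hxS, mem_subdiff_of_conj_prox hgp hgc hgl hv hγ (hz k)⟩

/-- The value of `θ` in terms of real numbers. -/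
lemma IsAlgoSeq.theta_mul {S : Set E} {g : F → EReal} {h : E → ℝ} {h' : E → E} {f : G → EReal}
    {A : E →L[ℝ] F} {K : E →L[ℝ] G} {γ δ β Lh : ℝ} {x u : ℕ → E} {y : ℕ → G} {z : ℕ → F}
    {θ : ℕ → ℝ} (halg : IsAlgoSeq S g h h' f A K γ δ β x u y z θ)
    (hA1 : Assumption1 S g h h' Lh f A K) (hA2 : Assumption2 S g A) (hγ : 0 < γ) (k : ℕ) :
    θ k * (f (K (x k))).toReal = (g (A (x k) - γ • z k)).toReal + γ / 2 * ‖z k‖ ^ 2 + h (x k)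
      + δ / 2 * ‖x k - u k‖ ^ 2 := by
  obtain ⟨hxS, hz⟩ := halg.mem_subdiff hA1 hA2 hγ k
  obtain ⟨-, -, hθ, -⟩ := halg
  obtain ⟨-, -, -, hgp, -, -, -, hfp, -, -, hK, -⟩ := hA1
  have := (hθ k).2
  rw [psi_eq_coe hgp h A δ γ hxS hz, ← hfp.coe_toReal (interior_subset (hK _ hxS)),
    ← EReal.coe_mul] at this
  exact EReal.coe_eq_coe_iff.1 this

lemma IsAlgoSeq.inner_nonneg {S : Set E} {g : F → EReal} {h : E → ℝ} {h' : E → E}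
    {f : G → EReal} {A : E →L[ℝ] F} {K : E →L[ℝ] G} {γ δ β : ℝ} {x u : ℕ → E} {y : ℕ → G}
    {z : ℕ → F} {θ : ℕ → ℝ} (halg : IsAlgoSeq S g h h' f A K γ δ β x u y z θ)
    (hS : Convex ℝ S) (k : ℕ) {w : E} (hw : w ∈ S) :
    0 ≤ ⟪ContinuousLinearMap.adjoint A (z k) - θ k • ContinuousLinearMap.adjoint K (y (k + 1))
      + h' (x k) + δ • (x (k + 1) - u k), w - x (k + 1)⟫ := by
  obtain ⟨-, -, -, -, hx, -⟩ := halg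
  refine inner_nonneg_of_forall_le hS (hx k).1 (fun w hw => ?_) hw
  have := (hx k).2 w hw
  simp only [inner_add_left, inner_sub_left, inner_smul_left, conj_trivial,
    ContinuousLinearMap.adjoint_inner_left]
  rwa [real_inner_comm (K (x (k + 1))), real_inner_comm (K w)]

/-- Sufficient decrease of `θ`. -/
lemma IsAlgoSeq.decrease {S : Set E} {g : F → EReal} {h : E → ℝ} {h' : E → E} {f : G → EReal}
    {A : E →L[ℝ] F} {K : E →L[ℝ] G} {γ δ β Lh ν : ℝ} {x u : ℕ → E} {y : ℕ → G} {z : ℕ → F}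
    {θ : ℕ → ℝ} (halg : IsAlgoSeq S g h h' f A K γ δ β x u y z θ)
    (hA1 : Assumption1 S g h h' Lh f A K) (hA2 : Assumption2 S g A) (hγ : 0 < γ)
    (hδ : δ = 2 * ν + Lh + 2 * ‖A‖ ^ 2 / γ) (hβ : β ∈ Ioo (0 : ℝ) 2) (k : ℕ) :
    ν * ‖x (k + 1) - x k‖ ^ 2 + ν * (1 - (1 - β) ^ 2) * ‖x (k + 1) - u k‖ ^ 2 ≤
      (f (K (x (k + 1)))).toReal * (θ k - θ (k + 1)) := by
  obtain ⟨hxS, hz⟩ := halg.mem_subdiff hA1 hA2 hγ k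
  obtain ⟨hxS', hz'⟩ := halg.mem_subdiff hA1 hA2 hγ (k + 1)
  have e1 := halg.theta_mul hA1 hA2 hγ k
  have e2 := halg.theta_mul hA1 hA2 hγ (k + 1)
  obtain ⟨hne, hS, -, hgp, -, -, ⟨O, hO, hSO, hgrad, hlip⟩, hfp, -, -, hK, -⟩ := hA1
  have i1 := halg.inner_nonneg hS k hxS
  obtain ⟨-, -, hθ, hy, -, hu⟩ := halg
  have i2 := ((mem_subdiff_iff hfp).1 (hy k)).2 _ (interior_subset (hK _ hxS'))
  have i3 := le_add_inner_add_of_lipschitz_gradient hS (fun x hx => hgrad x (hSO hx))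
    (fun x hx y hy => hlip x (hSO hx) y (hSO hy)) hxS hxS'
  have i4 := envelope_le hgp hγ hz hz'
  rw [← map_sub] at i2 i4
  have e3 : ‖x (k + 1) - u (k + 1)‖ ^ 2 = (1 - β) ^ 2 * ‖x (k + 1) - u k‖ ^ 2 := by
    have : x (k + 1) - u (k + 1) = (1 - β) • (x (k + 1) - u k) := by rw [hu k]; module
    rw [this, norm_smul, mul_pow, Real.norm_eq_abs, sq_abs]
  rw [e3] at e2
  have e4 : ‖x k - u k‖ ^ 2 = ‖x (k + 1) - u k‖ ^ 2 + 2 * ⟪x (k + 1) - u k, x k - x (k + 1)⟫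
      + ‖x (k + 1) - x k‖ ^ 2 := by
    rw [norm_sub_rev (x (k + 1)) (x k), ← norm_add_sq_real]
    congr 2
    abel
  rw [e4] at e1
  have e5 : x k - x (k + 1) = -(x (k + 1) - x k) := by abel
  rw [e5] at i1 e1
  set d := x (k + 1) - x k
  set r := x (k + 1) - u k
  simp only [inner_add_left, inner_sub_left, inner_smul_left, conj_trivial, inner_neg_right,
    ContinuousLinearMap.adjoint_inner_left] at i1 e1
  have i2' := mul_le_mul_of_nonneg_left i2 (hθ k).1.le
  have i5 : ‖A d‖ ^ 2 ≤ ‖A‖ ^ 2 * ‖d‖ ^ 2 := by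
    rw [← mul_pow]
    exact pow_le_pow_left₀ (norm_nonneg _) (A.le_opNorm d) 2
  have i5' : 1 / (2 * γ) * ‖A d‖ ^ 2 ≤ 1 / 2 * (‖A‖ ^ 2 / γ * ‖d‖ ^ 2) := by
    have := mul_le_mul_of_nonneg_left i5 (by positivity : 0 ≤ 1 / (2 * γ))
    refine this.trans (le_of_eq ?_)
    field_simp
  have i6 : 0 ≤ ‖A‖ ^ 2 / γ * ‖d‖ ^ 2 := by positivity
  have i7 : ν * ‖r‖ ^ 2 ≤ δ / 2 * ‖r‖ ^ 2 := by
    have h1 := mul_norm_sq_nonneg_of_lipschitz hO (hne.mono hSO) hlip r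
    have h2 : 0 ≤ ‖A‖ ^ 2 / γ * ‖r‖ ^ 2 := by positivity
    have h3 : δ / 2 * ‖r‖ ^ 2 = ν * ‖r‖ ^ 2 + 1 / 2 * (Lh * ‖r‖ ^ 2)
      + ‖A‖ ^ 2 / γ * ‖r‖ ^ 2 := by rw [hδ]; ring
    linarith
  have i8 := mul_le_mul_of_nonneg_right i7
    (by nlinarith [hβ.1, hβ.2] : 0 ≤ 1 - (1 - β) ^ 2)
  have e6 : δ / 2 * ‖d‖ ^ 2 = ν * ‖d‖ ^ 2 + Lh / 2 * ‖d‖ ^ 2 + ‖A‖ ^ 2 / γ * ‖d‖ ^ 2 := by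
    rw [hδ]; ring
  linarith

lemma ConvexFn.continuousAt_toReal {f : E → EReal} (hp : ProperFn f) (hf : ConvexFn f) {a : E}
    (ha : a ∈ interior (edom f)) : ContinuousAt (fun x => (f x).toReal) a :=
  (hf.convexOn_toReal hp).locallyLipschitzOn_interior.continuousOn.continuousAt
    (isOpen_interior.mem_nhds ha)

/-- Closedness of the graph of the subdifferential over the interior of the domain. -/
lemma mem_subdiff_of_tendsto {ι : Type*} {l : Filter ι} [l.NeBot] {f : E → EReal}
    (hp : ProperFn f) (hf : ConvexFn f) {a v : ι → E} {b w : E} (hb : b ∈ interior (edom f))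
    (ha : Tendsto a l (𝓝 b)) (hv : Tendsto v l (𝓝 w)) (h : ∀ᶠ k in l, v k ∈ subdiff f (a k)) :
    w ∈ subdiff f b := by
  refine (mem_subdiff_iff hp).2 ⟨interior_subset hb, fun y hy => ?_⟩
  have hlim : Tendsto (fun k => (f (a k)).toReal + ⟪v k, y - a k⟫) l
      (𝓝 ((f b).toReal + ⟪w, y - b⟫)) :=
    ((hf.continuousAt_toReal hp hb).tendsto.comp ha).add (hv.inner (tendsto_const_nhds.sub ha))
  exact le_of_tendsto hlim (h.mono fun k hk => ((mem_subdiff_iff hp).1 hk).2 y hy)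

/-- Local boundedness of the subdifferential on the interior of the domain. -/
lemma exists_norm_le_of_mem_subdiff {f : E → EReal} (hp : ProperFn f) (hf : ConvexFn f) {b : E}
    (hb : b ∈ interior (edom f)) :
    ∃ C : ℝ, ∀ᶠ a in 𝓝 b, ∀ v ∈ subdiff f a, ‖v‖ ≤ C := by
  obtain ⟨C, t, ht, hlip⟩ := (hf.convexOn_toReal hp).locallyLipschitzOn_interior hb
  rw [isOpen_interior.nhdsWithin_eq hb] at ht
  have hmem : t ∩ interior (edom f) ∈ 𝓝 b := inter_mem ht (isOpen_interior.mem_nhds hb)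
  refine ⟨C, (eventually_mem_nhds_iff.2 hmem).mono fun a ha v hv => ?_⟩
  exact norm_le_of_mem_subdiff hp (hlip.mono inter_subset_left)
    (inter_subset_right.trans interior_subset) ha hv

lemma exists_tendsto_of_eventually_mem {ι X : Type*} [TopologicalSpace X] {s : Set X}
    (hs : IsCompact s) (l : Ultrafilter ι) {f : ι → X} (hf : ∀ᶠ k in (l : Filter ι), f k ∈ s) :
    ∃ a ∈ s, Tendsto f l (𝓝 a) :=
  hs.ultrafilter_le_nhds (l.map f) (le_principal_iff.2 hf)

lemma isCompact_setOf_infDist_le {S : Set E} (hS : IsCompact S) (hne : S.Nonempty) (ε : ℝ) :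
    IsCompact {w : E | infDist w S ≤ ε} := by
  refine isCompact_of_isClosed_isBounded (isClosed_le (continuous_infDist_pt S) continuous_const) ?_
  refine (hS.isBounded.thickening (δ := ε + 1)).subset fun w hw => ?_
  rw [mem_thickening_iff_infDist_lt hne]
  exact (show infDist w S ≤ ε from hw).trans_lt (lt_add_one ε)

/-- A convex function is Lipschitz on compact subsets of the interior of its domain. -/
lemma ConvexFn.exists_abs_sub_le {f : E → EReal} (hp : ProperFn f) (hf : ConvexFn f) {S : Set E}
    (hS : IsCompact S) (hSd : S ⊆ interior (edom f)) :
    ∃ κ : ℝ, 0 < κ ∧ ∀ a ∈ S, ∀ b ∈ S, |(f a).toReal - (f b).toReal| ≤ κ * ‖a - b‖ := by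
  obtain ⟨C, hC⟩ := ((hf.convexOn_toReal hp).locallyLipschitzOn_interior.mono
    hSd).exists_lipschitzOnWith_of_compact hS
  refine ⟨C + 1, by positivity, fun a ha b hb => ?_⟩
  have := hC.dist_le_mul a ha b hb
  rw [Real.dist_eq, dist_eq_norm] at this
  linarith [norm_nonneg (a - b)]

/-- Shifting a subgradient at a nearby point costs a controlled error. -/
lemma mem_epsSubdiff_of_mem_subdiff {f : E → EReal} (hp : ProperFn f) {a p v : E} {η : ℝ}
    (ha : a ∈ edom f) (hv : v ∈ subdiff f p)
    (hη : (f a).toReal - (f p).toReal ≤ η + ⟪v, a - p⟫) : v ∈ epsSubdiff f η a := by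
  refine (mem_epsSubdiff_iff hp).2 ⟨ha, fun y hy => ?_⟩
  have h1 := ((mem_subdiff_iff hp).1 hv).2 y hy
  have h2 : ⟪v, y - p⟫ = ⟪v, y - a⟫ + ⟪v, a - p⟫ := by
    rw [← inner_add_right, sub_add_sub_cancel]
  linarith

/-- Convergence of `θ` and vanishing of the increments. -/
lemma IsAlgoSeq.tendsto {S : Set E} {g : F → EReal} {h : E → ℝ} {h' : E → E} {f : G → EReal}
    {A : E →L[ℝ] F} {K : E →L[ℝ] G} {γ δ β Lh ν : ℝ} {x u : ℕ → E} {y : ℕ → G} {z : ℕ → F}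
    {θ : ℕ → ℝ} (halg : IsAlgoSeq S g h h' f A K γ δ β x u y z θ)
    (hA1 : Assumption1 S g h h' Lh f A K) (hA2 : Assumption2 S g A) (hγ : 0 < γ) (hν : 0 < ν)
    (hδ : δ = 2 * ν + Lh + 2 * ‖A‖ ^ 2 / γ) (hβ : β ∈ Ioo (0 : ℝ) 2) :
    (∃ t, Tendsto θ atTop (𝓝 t)) ∧ Tendsto (fun k => x (k + 1) - x k) atTop (𝓝 0) ∧
      Tendsto (fun k => x (k + 1) - u k) atTop (𝓝 0) := by
  have hdec := halg.decrease hA1 hA2 hγ hδ hβ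
  have hxS := fun k => (halg.mem_subdiff hA1 hA2 hγ k).1
  obtain ⟨hne, -, hcomp, -, -, -, -, hfp, hfc, -, hK, hfpos, -⟩ := hA1
  obtain ⟨-, -, hθ, -⟩ := halg
  have hcont : ContinuousOn (fun w => (f (K w)).toReal) S := fun w hw =>
    (ContinuousAt.comp (f := K) (g := fun v => (f v).toReal)
      (hfc.continuousAt_toReal hfp (hK w hw)) K.continuous.continuousAt).continuousWithinAt
  obtain ⟨b, -, hb⟩ := hcomp.exists_isMaxOn hne hcont
  have hc : 0 < 1 - (1 - β) ^ 2 := by nlinarith [hβ.1, hβ.2]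
  have hpos : ∀ k, 0 < (f (K (x k))).toReal := fun k =>
    EReal.toReal_pos (hfpos _ (hxS k)) (interior_subset (hK _ (hxS k)))
  obtain ⟨hlim, h0⟩ := tendsto_of_le_mul_sub (fun k => (hθ k).1) (fun k => by positivity)
    hpos (fun k => hb (hxS k)) hdec
  have aux : ∀ (v : ℕ → E) (c : ℝ), 0 < c → (∀ k, c * ‖v k‖ ^ 2 ≤ ν * ‖x (k + 1) - x k‖ ^ 2 +
      ν * (1 - (1 - β) ^ 2) * ‖x (k + 1) - u k‖ ^ 2) → Tendsto v atTop (𝓝 0) := by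
    intro v c hc hv
    have h1 : Tendsto (fun k => c * ‖v k‖ ^ 2) atTop (𝓝 0) :=
      squeeze_zero (fun k => by positivity) hv h0
    have h2 : Tendsto (fun k => ‖v k‖ ^ 2) atTop (𝓝 0) := by
      simpa [hc.ne'] using h1.const_mul c⁻¹
    rw [tendsto_zero_iff_norm_tendsto_zero]
    simpa [Real.sqrt_sq] using h2.sqrt
  refine ⟨hlim, aux _ ν hν fun k => ?_, aux _ (ν * (1 - (1 - β) ^ 2)) (by positivity) fun k => ?_⟩
  · exact le_add_of_nonneg_right (by positivity)
  · exact le_add_of_nonneg_left (by positivity)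

theorem accumulation_points_lifted_stationary
    (S : Set E) (g : F → EReal) (h : E → ℝ) (h' : E → E) (Lh : ℝ)
    (f : G → EReal) (A : E →L[ℝ] F) (K : E →L[ℝ] G)
    (hA1 : Assumption1 S g h h' Lh f A K) (hA2 : Assumption2 S g A)
    (γ ν β δ : ℝ) (hγ : 0 < γ) (hν : 0 < ν) (hβ : β ∈ Ioo (0 : ℝ) 2)
    (hδ : δ = 2 * ν + Lh + 2 * ‖A‖ ^ 2 / γ)
    (x u : ℕ → E) (y : ℕ → G) (z : ℕ → F) (θ : ℕ → ℝ)
    (halg : IsAlgoSeq S g h h' f A K γ δ β x u y z θ)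
    (ε : ℝ) (hε : 0 < ε)
    (hzb : ∀ k, ‖z (k + 1)‖ ≤ min (ε / γ) (Real.sqrt (2 * ε / γ)))
    (hKε : {w : F | infDist w (A '' S) ≤ ε} ⊆ interior (edom g)) :
    ∃ κ : ℝ, 0 < κ ∧
      (∀ a ∈ {w : F | infDist w (A '' S) ≤ ε}, ∀ b ∈ {w : F | infDist w (A '' S) ≤ ε},
        g a ≤ g b + ((κ * ‖a - b‖ : ℝ) : EReal)) ∧
      ∀ xb : E, (∃ φ : ℕ → ℕ, StrictMono φ ∧ Tendsto (fun j => x (φ j)) atTop (nhds xb)) →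
        IsLiftedStat S g h h' f A K (2 * κ * ε) ((2 * κ + 1) * ε) xb := by
  obtain ⟨hne, hS, hcomp, hgp, hgc, hgl, ⟨O, hO, hSO, hgrad, hlip⟩, hfp, hfc, -, hK, -⟩ :=
    id hA1
  have hmemK : ∀ a ∈ S, ∀ v : F, γ * ‖v‖ ≤ ε →
      A a - γ • v ∈ {w : F | infDist w (A '' S) ≤ ε} := by
    intro a ha v hv
    refine (infDist_le_dist_of_mem (mem_image_of_mem A ha)).trans ?_
    rwa [dist_eq_norm, sub_sub_cancel_left, norm_neg, norm_smul, Real.norm_of_nonneg hγ.le]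
  obtain ⟨κ, hκ, hκlip⟩ := hgc.exists_abs_sub_le hgp
    (isCompact_setOf_infDist_le (hcomp.image A.continuous) (hne.image A) ε) hKε
  refine ⟨κ, hκ, fun a ha b hb => ?_, ?_⟩
  · rw [← hgp.coe_toReal (interior_subset (hKε ha)), ← hgp.coe_toReal (interior_subset (hKε hb)),
      ← EReal.coe_add, EReal.coe_le_coe_iff]
    linarith [(abs_le.1 (hκlip a ha b hb)).2]
  rintro xb ⟨φ, hφ, hφx⟩
  obtain ⟨⟨t, ht⟩, hdx, hdu⟩ := halg.tendsto hA1 hA2 hγ hν hδ hβ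
  have hmem := halg.mem_subdiff hA1 hA2 hγ
  have hθ := halg.theta_mul hA1 hA2 hγ
  set l : Ultrafilter ℕ := Ultrafilter.of (map φ atTop)
  have hlφ : (l : Filter ℕ) ≤ map φ atTop := Ultrafilter.of_le _
  have hltop : (l : Filter ℕ) ≤ atTop := hlφ.trans hφ.tendsto_atTop
  have hx : Tendsto x l (𝓝 xb) := (tendsto_map'_iff.2 hφx).mono_left hlφ
  replace ht := ht.mono_left hltop
  replace hdx := hdx.mono_left hltop
  replace hdu := hdu.mono_left hltop
  have hxb : xb ∈ S := hcomp.isClosed.mem_of_tendsto hx (Eventually.of_forall fun k => (hmem k).1)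
  have hx' : Tendsto (fun k => x (k + 1)) l (𝓝 xb) := by simpa using hdx.add hx
  have hxu : Tendsto (fun k => x k - u k) l (𝓝 0) := by simpa using hdu.sub hdx
  have hzle : ∀ᶠ k in (l : Filter ℕ), z k ∈ closedBall 0 (min (ε / γ) √(2 * ε / γ)) := by
    filter_upwards [hltop (eventually_ge_atTop 1)] with k hk
    obtain ⟨k, rfl⟩ := Nat.exists_eq_add_of_le' hk
    simpa using hzb k
  obtain ⟨zb, hzbb, hz⟩ := exists_tendsto_of_eventually_mem (isCompact_closedBall _ _) l hzle
  rw [mem_closedBall_zero_iff, le_min_iff] at hzbb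
  have hzb1 : γ * ‖zb‖ ≤ ε := by rw [mul_comm]; exact (le_div_iff₀ hγ).1 hzbb.1
  have hzb2 : γ / 2 * ‖zb‖ ^ 2 ≤ ε := by
    have h1 := pow_le_pow_left₀ (norm_nonneg zb) hzbb.2 2
    rw [Real.sq_sqrt (by positivity), le_div_iff₀ hγ] at h1
    linarith
  obtain ⟨C, hC⟩ := exists_norm_le_of_mem_subdiff hfp hfc (hK xb hxb)
  have hKx : Tendsto (fun k => K (x k)) l (𝓝 (K xb)) := (K.continuous.tendsto xb).comp hx
  have hy := halg.2.2.2.1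
  obtain ⟨yb, -, hyb⟩ := exists_tendsto_of_eventually_mem (isCompact_closedBall (0 : G) C) l
    (f := fun k => y (k + 1))
    ((hKx.eventually hC).mono fun k hk => mem_closedBall_zero_iff.2 (hk _ (hy k)))
  have hysub := mem_subdiff_of_tendsto hfp hfc (hK xb hxb) hKx hyb (Eventually.of_forall hy)
  have hp : Tendsto (fun k => A (x k) - γ • z k) l (𝓝 (A xb - γ • zb)) :=
    ((A.continuous.tendsto xb).comp hx).sub (hz.const_smul γ)
  have hpK := hmemK xb hxb zb hzb1
  have hAK : A xb ∈ {w : F | infDist w (A '' S) ≤ ε} := by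
    simpa using hmemK xb hxb 0 (by simpa using hε.le)
  have hzsub := mem_subdiff_of_tendsto hgp hgc (hKε hpK) hp hz
    (Eventually.of_forall fun k => (hmem k).2)
  have hh' : Tendsto (fun k => h' (x k)) l (𝓝 (h' xb)) := by
    rw [tendsto_iff_norm_sub_tendsto_zero]
    refine squeeze_zero (fun k => norm_nonneg _)
      (fun k => hlip _ (hSO (hmem k).1) _ (hSO hxb)) ?_
    simpa using (tendsto_iff_norm_sub_tendsto_zero.1 hx).const_mul Lh
  have hlimΨ : t * (f (K xb)).toReal =
      (g (A xb - γ • zb)).toReal + γ / 2 * ‖zb‖ ^ 2 + h xb := by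
    have h1 := ht.mul ((hfc.continuousAt_toReal hfp (hK xb hxb)).tendsto.comp hKx)
    have h2 := ((((hgc.continuousAt_toReal hgp (hKε hpK)).tendsto.comp hp).add
      ((hz.norm.pow 2).const_mul (γ / 2))).add
      ((hgrad xb (hSO hxb)).continuousAt.tendsto.comp hx)).add
      ((hxu.norm.pow 2).const_mul (δ / 2))
    have h3 := tendsto_nhds_unique (h1.congr fun k => hθ k) h2
    simpa using h3
  have hlipb := abs_le.1 (hκlip _ hpK _ hAK)
  rw [sub_sub_cancel_left, norm_neg, norm_smul, Real.norm_of_nonneg hγ.le] at hlipb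
  have hκε : κ * (γ * ‖zb‖) ≤ κ * ε := mul_le_mul_of_nonneg_left hzb1 hκ.le
  have hκε0 : 0 < κ * ε := mul_pos hκ hε
  have hz0 : 0 ≤ γ / 2 * ‖zb‖ ^ 2 := by positivity
  refine ⟨t * (f (K xb)).toReal, ?_, zb, ?_,
    t • ContinuousLinearMap.adjoint K yb - ContinuousLinearMap.adjoint A zb - h' xb, ?_,
    yb, hysub, ?_⟩
  · rw [hlimΨ, abs_le]
    constructor <;> linarith
  · refine mem_epsSubdiff_of_mem_subdiff hgp (interior_subset (hKε hAK)) hzsub ?_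
    rw [sub_sub_cancel, inner_smul_right, real_inner_self_eq_norm_sq]
    linarith
  · refine mem_subdiff_indicatorFn hxb fun w hw => ?_
    have h1 := ((((((ContinuousLinearMap.adjoint A).continuous.tendsto zb).comp hz).sub
      (ht.smul (((ContinuousLinearMap.adjoint K).continuous.tendsto yb).comp hyb))).add
      hh').add (hdu.const_smul δ)).inner (𝕜 := ℝ)
      ((tendsto_const_nhds (x := w)).sub hx')
    have h2 := ge_of_tendsto h1 (Eventually.of_forall fun k => halg.inner_nonneg hS k hw)
    rw [smul_zero, add_zero] at h2
    rw [← neg_nonneg, ← inner_neg_left]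
    refine h2.trans_eq ?_
    congr 1
    abel
  · module

end FracPaper
end
end
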